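/- Let T = (T₁,…,Tₙ) be commuting contractions on H. A self-adjoint X ∈ B(H) satisfies Tᵢ* X Tᵢ ≥ X for all i if and only if X = U − N where U is a self-adjoint operator with Tᵢ* U Tᵢ = U for all i, and N is a positive operator with Tᵢ* N Tᵢ ≤ N for all i and T^{*α} N T^{α} → 0 in SOT as α → ∞. Moreover this decomposition is unique. -/

import Mathlib

open ContinuousLinearMap Filter Topology

section ListProd

variable {M : Type*} [Monoid M]

theorem List.prod_ofFn_mul_of_commute {n : ℕ} (a b : Fin n → M)
    (hab : ∀ i j, Commute (a i) (b j)) :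
    (List.ofFn fun i => a i * b i).prod = (List.ofFn a).prod * (List.ofFn b).prod := by
  induction n with
  | zero => simp
  | succ n ih =>
    have hcomm : Commute (b 0) (List.ofFn fun i : Fin n => a i.succ).prod := by
      refine Commute.list_prod_right _ _ fun x hx => ?_
      obtain ⟨i, rfl⟩ := (List.mem_ofFn' _ _).1 hx
      exact (hab _ _).symm
    simp only [List.ofFn_succ, List.prod_cons]
    rw [ih (fun i => a i.succ) (fun i => b i.succ) fun i j => hab _ _]
    simp only [mul_assoc]
    rw [← mul_assoc (b 0), hcomm.eq, mul_assoc]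

theorem List.prod_ofFn_pow_single {n : ℕ} (a : Fin n → M) (i : Fin n) :
    (List.ofFn fun j => a j ^ (Pi.single i 1 : Fin n → ℕ) j).prod = a i := by
  induction n with
  | zero => exact i.elim0
  | succ n ih =>
    rw [List.ofFn_succ, List.prod_cons]
    cases i using Fin.cases with
    | zero => simp
    | succ i =>
      have hs : ∀ j : Fin n, (Pi.single i.succ 1 : Fin (n + 1) → ℕ) j.succ =
          (Pi.single i 1 : Fin n → ℕ) j := fun j => by
        simp [Pi.single_apply]
      simp only [hs, ih (fun j => a j.succ) i]
      simp [(Fin.succ_ne_zero i).symm]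

theorem List.prod_ofFn_pow_mem {S : Type*} [SetLike S M] [SubmonoidClass S M] (s : S) {n : ℕ}
    {a : Fin n → M} (ha : ∀ i, a i ∈ s) (α : Fin n → ℕ) :
    (List.ofFn fun i => a i ^ α i).prod ∈ s := by
  refine list_prod_mem fun x hx => ?_
  obtain ⟨i, rfl⟩ := (List.mem_ofFn' _ _).1 hx
  exact pow_mem (ha i) _

end ListProd

section StarConjugation

variable {R : Type*} [Ring R] [StarRing R]

/-- The elements `s` with `X ≤ s* X s`. -/
def upperToeplitzSubmonoid [PartialOrder R] [StarOrderedRing R] (X : R) : Submonoid R where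
  carrier := {s | X ≤ star s * X * s}
  one_mem' := by simp
  mul_mem' {a b} ha hb := by
    have h := hb.trans (star_left_conjugate_le_conjugate ha b)
    simpa [mul_assoc] using h

/-- The elements `s` with `s* X s = X`. -/
def toeplitzSubmonoid (X : R) : Submonoid R where
  carrier := {s | star s * X * s = X}
  one_mem' := by simp
  mul_mem' {a b} ha hb := by
    have ha : star a * X * a = X := ha
    have hb : star b * X * b = X := hb
    calc star (a * b) * X * (a * b) = star b * (star a * X * a) * b := by
          simp only [star_mul, mul_assoc]
      _ = X := by rw [ha, hb]

end StarConjugation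

/-- The elements of norm at most one. -/
def contractionSubmonoid (A : Type*) [SeminormedRing A] [NormOneClass A] : Submonoid A where
  carrier := {s | ‖s‖ ≤ 1}
  one_mem' := norm_one.le
  mul_mem' {a b} ha hb := (norm_mul_le a b).trans (mul_le_one₀ ha (norm_nonneg b) hb)

namespace ContinuousLinearMap

variable {H : Type*} [NormedAddCommGroup H] [InnerProductSpace ℂ H]

theorem isPositive_of_tendsto {ι : Type*} {l : Filter ι} [l.NeBot] {A : ι → H →L[ℂ] H}
    {U : H →L[ℂ] H} (hA : ∀ i, (A i).IsPositive)
    (hU : ∀ h, Tendsto (fun i => A i h) l (𝓝 (U h))) : U.IsPositive := by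
  refine ⟨fun x y => ?_, fun x => ?_⟩
  · refine tendsto_nhds_unique ((hU x).inner tendsto_const_nhds) ?_
    refine (tendsto_const_nhds.inner (hU y)).congr fun i => ?_
    exact ((hA i).inner_left_eq_inner_right x y).symm
  · refine ge_of_tendsto (x := l) (f := fun i => (A i).reApplyInnerSelf x) ?_ ?_
    · exact (RCLike.continuous_re.tendsto _).comp ((hU x).inner tendsto_const_nhds)
    · exact Eventually.of_forall fun i => (hA i).re_inner_nonneg_left x

variable [CompleteSpace H]

theorem IsPositive.norm_apply_sq_le {B : H →L[ℂ] H} (hB : B.IsPositive) (h : H) :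
    ‖B h‖ ^ 2 ≤ ‖B‖ * RCLike.re (inner ℂ (B h) h) := by
  obtain ⟨C, rfl⟩ := CStarAlgebra.nonneg_iff_eq_star_mul_self.1 (nonneg_iff_isPositive B |>.2 hB)
  have hinner : RCLike.re (inner ℂ ((star C * C) h) h) = ‖C h‖ ^ 2 := by
    rw [star_eq_adjoint, mul_def, comp_apply, adjoint_inner_left, inner_self_eq_norm_sq]
  have hle : ‖(star C * C) h‖ ≤ ‖C‖ * ‖C h‖ :=
    norm_star C ▸ (star C).le_opNorm (C h)
  rw [hinner, CStarRing.norm_star_mul_self]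
  calc ‖(star C * C) h‖ ^ 2 ≤ (‖C‖ * ‖C h‖) ^ 2 := by gcongr
    _ = ‖C‖ * ‖C‖ * ‖C h‖ ^ 2 := by ring

/-- A norm-bounded increasing net of operators converges strongly. -/
theorem exists_tendsto_of_monotone {ι : Type*} [SemilatticeSup ι] [Nonempty ι]
    {A : ι → H →L[ℂ] H} (hA : Monotone A) {C : ℝ} (hC : ∀ i, ‖A i‖ ≤ C) :
    ∃ U : H →L[ℂ] H, ∀ h, Tendsto (fun i => A i h) atTop (𝓝 (U h)) := by
  have hlim : ∀ h, ∃ y, Tendsto (fun i => A i h) atTop (𝓝 y) := by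
    intro h
    set q : ι → ℝ := fun i => RCLike.re (inner ℂ (A i h) h) with hq
    have hsub : ∀ i j, RCLike.re (inner ℂ ((A j - A i) h) h) = q j - q i := fun i j => by
      rw [sub_apply, inner_sub_left, map_sub]
    have hqmono : Monotone q := fun i j hij => by
      have := (le_def _ _).1 (hA hij) |>.re_inner_nonneg_left h
      rw [hsub] at this
      linarith
    have hqbdd : BddAbove (Set.range q) := by
      refine ⟨C * ‖h‖ * ‖h‖, ?_⟩
      rintro _ ⟨i, rfl⟩
      exact (re_inner_le_norm _ _).trans
        (mul_le_mul_of_nonneg_right ((A i).le_of_opNorm_le (hC i) h) (norm_nonneg h))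
    have hqlim : Tendsto q atTop (𝓝 (⨆ i, q i)) := tendsto_atTop_ciSup hqmono hqbdd
    have hqc : CauchySeq q := hqlim.cauchySeq
    have hC0 : 0 ≤ C := (norm_nonneg _).trans (hC (Classical.arbitrary ι))
    have hdist : ∀ i j, i ≤ j → ‖A j h - A i h‖ ^ 2 ≤ 2 * C * (q j - q i) := fun i j hij => by
      have h1 := ((le_def _ _).1 (hA hij)).norm_apply_sq_le h
      rw [hsub, sub_apply] at h1
      refine h1.trans (mul_le_mul_of_nonneg_right ?_ (sub_nonneg.2 (hqmono hij)))
      exact (norm_sub_le _ _).trans (by linarith [hC i, hC j])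
    refine cauchySeq_tendsto_of_complete (Metric.cauchySeq_iff'.2 fun ε hε => ?_)
    obtain ⟨N, hN⟩ := Metric.cauchySeq_iff'.1 hqc (ε ^ 2 / (2 * C + 1)) (by positivity)
    refine ⟨N, fun i hi => ?_⟩
    rw [dist_eq_norm]
    have hqi : q i - q N < ε ^ 2 / (2 * C + 1) := (le_abs_self _).trans_lt (hN i hi)
    rw [lt_div_iff₀ (by positivity)] at hqi
    refine lt_of_pow_lt_pow_left₀ 2 hε.le ?_
    nlinarith [hdist N i hi, hqmono hi]
  choose f hf using hlim
  refine ⟨ofTendstoOfBoundedRange f A (tendsto_pi_nhds.2 hf) ?_, hf⟩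
  refine isBounded_iff_forall_norm_le.2 ⟨C, ?_⟩
  rintro _ ⟨i, rfl⟩
  exact hC i

theorem adjoint_comp_comp_eq_star_conj (S X : H →L[ℂ] H) :
    adjoint S ∘L X ∘L S = star S * X * S := by
  rw [mul_assoc]; rfl

end ContinuousLinearMap

/-- A self-adjoint `X` satisfies `Tᵢ* X Tᵢ ≥ X` for all `i` iff `X = U − N`
where `U` is a self-adjoint `T`-Toeplitz operator and `N` is a positive lower
`T`-Toeplitz operator with `T^{*α} N T^α → 0` in SOT; moreover the
decomposition is unique. -/
theorem upper_toeplitz_decomposition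
    {H : Type*} [NormedAddCommGroup H] [InnerProductSpace ℂ H] [CompleteSpace H]
    (n : ℕ) (T : Fin n → H →L[ℂ] H)
    (hcomm : ∀ i j, Commute (T i) (T j)) (hcontr : ∀ i, ‖T i‖ ≤ 1)
    (Tpow : (Fin n → ℕ) → H →L[ℂ] H)
    (hTpow : ∀ α, Tpow α = (List.ofFn fun i => T i ^ α i).prod)
    (X : H →L[ℂ] H) (hX : IsSelfAdjoint X) :
    ((∀ i, (adjoint (T i) ∘L X ∘L T i - X).IsPositive) ↔
      ∃ U N : H →L[ℂ] H, IsSelfAdjoint U ∧ N.IsPositive ∧ X = U - N ∧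
        (∀ i, adjoint (T i) ∘L U ∘L T i = U) ∧
        (∀ i, (N - adjoint (T i) ∘L N ∘L T i).IsPositive) ∧
        (∀ h : H, Tendsto (fun α : Fin n → ℕ => (adjoint (Tpow α) ∘L N ∘L Tpow α) h)
          atTop (𝓝 0))) ∧
    (∀ U N U' N' : H →L[ℂ] H,
      (IsSelfAdjoint U ∧ N.IsPositive ∧ X = U - N ∧
        (∀ i, adjoint (T i) ∘L U ∘L T i = U) ∧
        (∀ i, (N - adjoint (T i) ∘L N ∘L T i).IsPositive) ∧
        (∀ h : H, Tendsto (fun α : Fin n → ℕ => (adjoint (Tpow α) ∘L N ∘L Tpow α) h)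
          atTop (𝓝 0))) →
      (IsSelfAdjoint U' ∧ N'.IsPositive ∧ X = U' - N' ∧
        (∀ i, adjoint (T i) ∘L U' ∘L T i = U') ∧
        (∀ i, (N' - adjoint (T i) ∘L N' ∘L T i).IsPositive) ∧
        (∀ h : H, Tendsto (fun α : Fin n → ℕ => (adjoint (Tpow α) ∘L N' ∘L Tpow α) h)
          atTop (𝓝 0))) →
      U = U' ∧ N = N') := by
  simp only [adjoint_comp_comp_eq_star_conj]
  have hadd : ∀ α β, Tpow (α + β) = Tpow α * Tpow β := fun α β => by
    simp only [hTpow, Pi.add_apply, pow_add]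
    exact List.prod_ofFn_mul_of_commute _ _ fun i j => (hcomm i j).pow_pow _ _
  have hsingle : ∀ i, Tpow (Pi.single i 1) = T i := fun i => by
    rw [hTpow, List.prod_ofFn_pow_single]
  have hzero : Tpow 0 = 1 := by
    rw [hTpow]
    exact List.prod_eq_one fun x hx => by
      obtain ⟨i, rfl⟩ := (List.mem_ofFn' _ _).1 hx
      simp
  have hfixed : ∀ U : H →L[ℂ] H, (∀ i, star (T i) * U * T i = U) →
      ∀ α, star (Tpow α) * U * Tpow α = U := fun U hU α => by
    rw [hTpow]
    exact List.prod_ofFn_pow_mem (toeplitzSubmonoid U) hU α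
  refine ⟨⟨fun hup => ?_, ?_⟩, ?_⟩
  · have hupper : ∀ α, X ≤ star (Tpow α) * X * Tpow α := fun α => by
      rw [hTpow]
      exact List.prod_ofFn_pow_mem (upperToeplitzSubmonoid X) hup α
    have hnorm : ∀ α, ‖Tpow α‖ ≤ 1 := fun α => by
      cases subsingleton_or_nontrivial H
      · simp [Subsingleton.elim (Tpow α) 0]
      · rw [hTpow]
        exact List.prod_ofFn_pow_mem (contractionSubmonoid (H →L[ℂ] H)) hcontr α
    have hconj : ∀ α β, star (Tpow (α + β)) * X * Tpow (α + β) =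
        star (Tpow β) * (star (Tpow α) * X * Tpow α) * Tpow β := fun α β => by
      simp only [hadd, star_mul, mul_assoc]
    have hmono : Monotone fun α => star (Tpow α) * X * Tpow α := fun α β hαβ => by
      obtain ⟨γ, rfl⟩ := exists_add_of_le hαβ
      change _ ≤ star (Tpow (α + γ)) * X * Tpow (α + γ)
      rw [add_comm α γ, hconj]
      exact star_left_conjugate_le_conjugate (hupper γ) (Tpow α)
    have hbound : ∀ α, ‖star (Tpow α) * X * Tpow α‖ ≤ ‖X‖ := fun α =>
      calc ‖star (Tpow α) * X * Tpow α‖ ≤ ‖star (Tpow α)‖ * ‖X‖ * ‖Tpow α‖ :=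
            (norm_mul_le _ _).trans (by gcongr; exact norm_mul_le _ _)
        _ ≤ 1 * ‖X‖ * 1 := by
            rw [norm_star]
            gcongr <;> exact hnorm α
        _ = ‖X‖ := by ring
    obtain ⟨U, hU⟩ := exists_tendsto_of_monotone hmono hbound
    have hUfix : ∀ i, star (T i) * U * T i = U := fun i => by
      ext h
      have hshift : Tendsto (fun α : Fin n → ℕ => α + Pi.single i 1) atTop atTop :=
        tendsto_atTop_mono (fun α => le_self_add) tendsto_id
      refine tendsto_nhds_unique ?_ ((hU h).comp hshift)
      refine (((star (T i)).continuous.tendsto _).comp (hU (T i h))).congr fun α => ?_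
      simp only [Function.comp_apply, hconj, hsingle]
      rfl
    have hN : (U - X).IsPositive := by
      refine isPositive_of_tendsto (l := atTop)
        (A := fun α : Fin n → ℕ => star (Tpow α) * X * Tpow α - X) hupper fun h => ?_
      simpa only [sub_apply] using (hU h).sub_const (X h)
    refine ⟨U, U - X, ?_, hN, by abel, hUfix, fun i => ?_, fun h => ?_⟩
    · simpa using hN.isSelfAdjoint.add hX
    · rw [mul_sub, sub_mul, hUfix]
      exact sub_le_sub_left (hup i) U
    · have hlim := (hU h).const_sub (U h)
      rw [sub_self] at hlim
      refine hlim.congr fun α => ?_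
      rw [mul_sub, sub_mul, hfixed U hUfix, sub_apply]
  · rintro ⟨U, N, -, -, rfl, hU, hN, -⟩ i
    rw [mul_sub, sub_mul, hU]
    exact sub_le_sub_left (hN i) U
  · rintro U N U' N' ⟨-, -, hX₁, hU, -, hN⟩ ⟨-, -, hX₂, hU', -, hN'⟩
    have hdiff : U - U' = N - N' := by
      rw [sub_eq_sub_iff_sub_eq_sub, ← hX₁, ← hX₂]
    have hUU' : U = U' := by
      ext h
      rw [← sub_eq_zero, ← sub_apply]
      have hlim := (hN h).sub (hN' h)
      rw [sub_self] at hlim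
      refine tendsto_nhds_unique (tendsto_const_nhds.congr fun α => ?_) hlim
      rw [← sub_apply, ← sub_mul, ← mul_sub, ← hdiff, mul_sub, sub_mul, hfixed U hU,
        hfixed U' hU']
    refine ⟨hUU', ?_⟩
    rwa [hUU', sub_self, eq_comm, sub_eq_zero] at hdiff
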